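/- Let m ∈ ℤ_{>0}. Then for all s, s₁ ∈ ℤ the functions Φ̃^{[m;s]} and Φ̃^{[m;s₁]} coincide (so one may write Φ̃^{[m]} for their common value), and Φ̃^{[m]} is fixed by the weight-1, degree-m action of SL₂(ℤ): for every (a b; c d) ∈ SL₂(ℤ), every τ with Im τ > 0 and all z₁, z₂ ∈ ℂ with z₁ ∉ ℤ + ℤτ, (cτ + d)^{−1} e^{−2πi m c z₁ z₂/(cτ+d)} Φ̃^{[m]}((aτ+b)/(cτ+d), z₁/(cτ+d), z₂/(cτ+d)) = Φ̃^{[m]}(τ, z₁, z₂). -/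

import Mathlib

noncomputable section

open Complex

/-- `mexp w = e^{2πi w}`. -/
def mexp (w : ℂ) : ℂ := Complex.exp (2 * (Real.pi : ℂ) * Complex.I * w)

/-- The signed mock theta function `Φ^{sgn[m;s]}(τ,z₁,z₂)`. -/
def PhiS (sgn : ℂ) (m s : ℝ) (τ z₁ z₂ : ℂ) : ℂ :=
  ∑' n : ℤ, sgn ^ n *
    mexp ((m : ℂ) * n * (z₁ + z₂) + (s : ℂ) * z₁ + τ * ((m : ℂ) * n ^ 2 + (s : ℂ) * n)) /
    (1 - mexp (z₁ + n * τ))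

/-- The signed theta function `Θ^{sgn}_{j,m}(τ,z)`. -/
def ThetaS (sgn : ℂ) (j m : ℝ) (τ z : ℂ) : ℂ :=
  ∑' n : ℤ, sgn ^ n *
    mexp ((m : ℂ) * z * ((n : ℂ) + ((j / (2 * m) : ℝ) : ℂ)) +
      τ * (m : ℂ) * ((n : ℂ) + ((j / (2 * m) : ℝ) : ℂ)) ^ 2)

/-- `E(x) = 2∫₀ˣ e^{-πu²} du`. -/
def Efun (x : ℝ) : ℝ := 2 * ∫ u in (0:ℝ)..x, Real.exp (-Real.pi * u ^ 2)

/-- `ψ_{m,n}(τ,z) = (n - 2m Im z / Im τ) √(Im τ / m)`. -/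
def psiMN (m n : ℝ) (τ z : ℂ) : ℝ := (n - 2 * m * z.im / τ.im) * Real.sqrt (τ.im / m)

/-- The real-analytic correction `R^{sgn}_{j,m}(τ,z)`; the summation variable `n ∈ j + 2mℤ`
is written as `n = j + 2mk`, `k ∈ ℤ`, so that `(±1)^{(n-j)/(2m)} = sgn^k`. -/
def RS (sgn : ℂ) (j m : ℝ) (τ z : ℂ) : ℂ :=
  ∑' k : ℤ, sgn ^ k *
    (((Real.sign (j + 2 * m * k - 1 / 2 - j + 2 * m) -
        Efun (psiMN m (j + 2 * m * k) τ z) : ℝ)) : ℂ) *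
    Complex.exp (-(Real.pi : ℂ) * Complex.I * (((j + 2 * m * k : ℝ)) : ℂ) ^ 2 * τ / (2 * (m : ℂ))
      + 2 * (Real.pi : ℂ) * Complex.I * (((j + 2 * m * k : ℝ)) : ℂ) * z)

/-- The modifier `Φ^{sgn[m;s]}_add`; the summation variable `j ∈ s + ℤ`, `s ≤ j < s + 2m`
is written as `j = s + i`, `0 ≤ i < ⌈2m⌉`. -/
def PhiAddS (sgn : ℂ) (m s : ℝ) (τ z₁ z₂ : ℂ) : ℂ :=
  ∑ i ∈ Finset.range ⌈2 * m⌉₊,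
    RS sgn (s + i) m τ ((z₁ - z₂) / 2) * ThetaS sgn (s + i) m τ (z₁ + z₂)

/-- The modified (signed) mock theta function `Φ̃^{sgn[m;s]}`. -/
def PhiTilde (sgn : ℂ) (m s : ℝ) (τ z₁ z₂ : ℂ) : ℂ :=
  PhiS sgn m s τ z₁ z₂ - (1 / 2) * PhiAddS sgn m s τ z₁ z₂

end

open Filter Topology Asymptotics
open scoped ComplexConjugate

/-! ### The error function -/

lemma hasDerivAt_Efun (x : ℝ) : HasDerivAt Efun (2 * Real.exp (-Real.pi * x ^ 2)) x := by
  have hc : Continuous fun u : ℝ => Real.exp (-Real.pi * u ^ 2) := by fun_prop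
  exact (intervalIntegral.integral_hasDerivAt_right (hc.intervalIntegrable _ _)
    (hc.stronglyMeasurableAtFilter _ _) hc.continuousAt).const_mul 2

lemma Efun_neg (x : ℝ) : Efun (-x) = -Efun x := by
  have h := intervalIntegral.integral_comp_neg (a := 0) (b := x)
    (fun u : ℝ => Real.exp (-Real.pi * u ^ 2))
  simp only [neg_sq, neg_zero] at h
  rw [Efun, Efun, h, intervalIntegral.integral_symm]
  ring

lemma abs_one_sub_Efun_le {x : ℝ} (hx : 0 ≤ x) :
    |1 - Efun x| ≤ Real.exp (-Real.pi * x ^ 2) := by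
  have hc : Continuous fun u : ℝ => Real.exp (-Real.pi * u ^ 2) := by fun_prop
  have hint : MeasureTheory.Integrable fun u : ℝ => Real.exp (-Real.pi * u ^ 2) :=
    integrable_exp_neg_mul_sq Real.pi_pos
  have hlim : Tendsto Efun atTop (𝓝 1) := by
    have h := (MeasureTheory.intervalIntegral_tendsto_integral_Ioi (0 : ℝ)
      hint.integrableOn tendsto_id).const_mul 2
    rw [integral_gaussian_Ioi, div_self Real.pi_ne_zero, Real.sqrt_one,
      mul_div_cancel₀ _ two_ne_zero] at h
    exact h
  have hmono : Monotone Efun :=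
    monotone_of_deriv_nonneg (fun y => (hasDerivAt_Efun y).differentiableAt) fun y => by
      rw [(hasDerivAt_Efun y).deriv]; positivity
  have hle (y : ℝ) : Efun y ≤ 1 := hmono.ge_of_tendsto hlim y
  rw [abs_of_nonneg (sub_nonneg.2 (hle x))]
  have hstep (y : ℝ) (hy : 0 ≤ y) :
      Efun (x + y) - Efun x ≤ Real.exp (-Real.pi * x ^ 2) := by
    have h1 : Efun (x + y) - Efun x =
        2 * ∫ u in (0 : ℝ)..y, Real.exp (-Real.pi * (x + u) ^ 2) := by
      have h2 := intervalIntegral.integral_comp_add_left (a := 0) (b := y)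
        (fun u : ℝ => Real.exp (-Real.pi * u ^ 2)) x
      simp only [add_zero] at h2
      rw [h2, Efun, Efun, ← mul_sub, intervalIntegral.integral_interval_sub_left
        (hc.intervalIntegrable _ _) (hc.intervalIntegrable _ _)]
    have h3 : ∫ u in (0 : ℝ)..y, Real.exp (-Real.pi * (x + u) ^ 2) ≤
        ∫ u in (0 : ℝ)..y, Real.exp (-Real.pi * x ^ 2) * Real.exp (-Real.pi * u ^ 2) := by
      refine intervalIntegral.integral_mono_on hy
        (Continuous.intervalIntegrable (by fun_prop) _ _)
        (Continuous.intervalIntegrable (by fun_prop) _ _) fun u hu => ?_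
      rw [← Real.exp_add, Real.exp_le_exp]
      nlinarith [Real.pi_pos, mul_nonneg Real.pi_pos.le (mul_nonneg hx hu.1)]
    rw [intervalIntegral.integral_const_mul] at h3
    have h4 : 2 * (Real.exp (-Real.pi * x ^ 2) *
        ∫ u in (0 : ℝ)..y, Real.exp (-Real.pi * u ^ 2)) =
        Real.exp (-Real.pi * x ^ 2) * Efun y := by rw [Efun]; ring
    have h5 : Real.exp (-Real.pi * x ^ 2) * Efun y ≤ Real.exp (-Real.pi * x ^ 2) * 1 :=
      mul_le_mul_of_nonneg_left (hle y) (Real.exp_pos _).le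
    linarith
  have hlim' : Tendsto (fun y => Efun (x + y) - Efun x) atTop (𝓝 (1 - Efun x)) :=
    (hlim.comp (tendsto_atTop_add_const_left _ x tendsto_id)).sub_const _
  exact le_of_tendsto hlim' ((eventually_ge_atTop 0).mono hstep)

/-! ### Gaussian sums -/

lemma summable_cexp_quadratic {c d : ℂ} (hc : c.re < 0) :
    Summable fun a : ℤ => Complex.exp (c * a ^ 2 + d * a) := by
  have hpi : (Real.pi : ℂ) ≠ 0 := by exact_mod_cast Real.pi_ne_zero
  have h : 0 < (c / (Real.pi * Complex.I)).im := by
    have : c / (Real.pi * Complex.I) = ((Real.pi⁻¹ : ℝ) : ℂ) * (-Complex.I * c) := by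
      push_cast; field_simp; rw [Complex.I_sq]; ring
    rw [this, Complex.im_ofReal_mul]
    have := Real.pi_pos
    simpa using mul_pos (inv_pos.2 this) (neg_pos.2 hc)
  refine ((summable_jacobiTheta₂_term_iff (d / (2 * Real.pi * Complex.I)) _).2 h).congr fun a => ?_
  rw [jacobiTheta₂_term]
  congr 1
  field_simp
  ring

/-- The sign which is `1` for `s ≤ a` and `-1` for `a < s`. -/
def stepSign (s a : ℤ) : ℝ := if s ≤ a then 1 else -1

lemma eventually_abs_stepSign_sub_Efun_le (s : ℤ) (α : ℝ) {t : ℝ} (ht : 0 < t) :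
    ∀ᶠ a : ℤ in cofinite, |stepSign s a - Efun ((a - α) * t)| ≤
      Real.exp (-Real.pi * ((a - α) * t) ^ 2) := by
  rw [Int.cofinite_eq, eventually_sup]
  constructor
  · filter_upwards [eventually_lt_atBot s, eventually_le_atBot ⌊α⌋] with a h1 h2
    have h3 : 0 ≤ -((a - α) * t) := by nlinarith [Int.le_floor.1 h2]
    have h4 := abs_one_sub_Efun_le h3
    rw [Efun_neg, neg_sq] at h4
    rwa [stepSign, if_neg (by omega), ← abs_neg, neg_sub, sub_neg_eq_add, add_comm,
      ← sub_neg_eq_add]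
  · filter_upwards [eventually_ge_atTop s, eventually_ge_atTop ⌈α⌉] with a h1 h2
    rw [stepSign, if_pos h1]
    exact abs_one_sub_Efun_le (mul_nonneg (sub_nonneg.2 (Int.ceil_le.1 h2)) ht.le)

lemma summable_stepSign_sub_Efun (s : ℤ) (α : ℝ) {t : ℝ} (ht : 0 < t) {c d : ℂ}
    (hc : c.re < Real.pi * t ^ 2) :
    Summable fun a : ℤ => ((stepSign s a - Efun ((a - α) * t) : ℝ) : ℂ) *
      Complex.exp (c * a ^ 2 + d * a) := by
  have hg : Summable fun a : ℤ => Complex.exp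
      ((c - (Real.pi * t ^ 2 : ℝ)) * a ^ 2 + (d + (2 * Real.pi * t ^ 2 * α : ℝ)) * a) :=
    summable_cexp_quadratic (by rw [Complex.sub_re, Complex.ofReal_re]; linarith)
  refine summable_of_isBigO hg.norm (IsBigO.of_bound 1 ?_)
  filter_upwards [eventually_abs_stepSign_sub_Efun_le s α ht] with a ha
  rw [norm_mul, Complex.norm_real, Real.norm_eq_abs, norm_norm, one_mul]
  refine (mul_le_mul_of_nonneg_right ha (norm_nonneg _)).trans ?_
  rw [Complex.norm_exp, Complex.norm_exp, ← Real.exp_add, Real.exp_le_exp]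
  have h1 : ((c - (Real.pi * t ^ 2 : ℝ)) * (a : ℂ) ^ 2 + (d + (2 * Real.pi * t ^ 2 * α : ℝ)) * a)
      = (c * a ^ 2 + d * a) +
        ((-(Real.pi * t ^ 2) * a ^ 2 + 2 * Real.pi * t ^ 2 * α * a : ℝ) : ℂ) := by
    push_cast; ring
  rw [h1, Complex.add_re _ (Complex.ofReal _), Complex.ofReal_re]
  nlinarith [mul_nonneg Real.pi_pos.le (sq_nonneg (t * α))]

/-! ### The one-dimensional Poisson-type identity -/

/-- The Gaussian `e^{-π w² / t² + 2πi α w}`. -/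
noncomputable def gaussTerm (t α : ℝ) (w : ℂ) : ℂ :=
  Complex.exp (-(Real.pi : ℂ) * (w / t) ^ 2 + 2 * Real.pi * Complex.I * α * w)

lemma summable_gaussTerm {t : ℝ} (ht : 0 < t) (α : ℝ) (w : ℂ) :
    Summable fun b : ℤ => gaussTerm t α (w + b) := by
  have ht' : (t : ℂ) ≠ 0 := by exact_mod_cast ht.ne'
  have hc : ((-(Real.pi / t ^ 2) : ℝ) : ℂ).re < 0 := by
    rw [Complex.ofReal_re]
    exact neg_neg_of_pos (div_pos Real.pi_pos (pow_pos ht 2))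
  refine ((summable_cexp_quadratic (d := -2 * Real.pi * w / t ^ 2 + 2 * Real.pi * Complex.I * α)
    hc).mul_left (gaussTerm t α w)).congr fun b => ?_
  rw [gaussTerm, gaussTerm, ← Complex.exp_add]
  congr 1
  push_cast
  field_simp
  ring

lemma summable_gaussTerm_div {t : ℝ} (ht : 0 < t) (α : ℝ) (w : ℂ) :
    Summable fun b : ℤ => gaussTerm t α (w + b) / (w + b) := by
  have h1 : (fun b : ℤ => (w + b)⁻¹) =O[cofinite] fun _ => (1 : ℝ) := by
    have h := EisensteinSeries.linear_inv_isBigO_right 1 w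
    simp only [Int.cast_one, one_mul] at h
    refine h.trans (IsBigO.of_bound 1 (Eventually.of_forall fun b => ?_))
    rcases eq_or_ne b 0 with rfl | hb
    · simp
    · rw [norm_inv, norm_one, mul_one]
      refine inv_le_one_of_one_le₀ ?_
      rw [Real.norm_eq_abs]
      exact_mod_cast Int.one_le_abs hb
  refine summable_of_isBigO (summable_gaussTerm ht α w).norm ?_
  have h2 := (isBigO_refl (fun b : ℤ => gaussTerm t α (w + b)) cofinite).norm_right.mul h1
  simpa only [div_eq_mul_inv, mul_one] using! h2

lemma tsum_gaussian_mul_mexp {t : ℝ} (ht : 0 < t) (α : ℝ) (w : ℂ) :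
    ∑' a : ℤ, ((t * Real.exp (-Real.pi * ((a - α) * t) ^ 2) : ℝ) : ℂ) * mexp (a * w) =
      ∑' b : ℤ, gaussTerm t α (w + b) := by
  have ht' : (t : ℂ) ≠ 0 := by exact_mod_cast ht.ne'
  have hfe := jacobiTheta₂_functional_equation (w - Complex.I * t ^ 2 * α) (Complex.I * t ^ 2)
  have hsqrt : (-Complex.I * (Complex.I * (t : ℂ) ^ 2)) ^ (1 / 2 : ℂ) = t := by
    rw [← mul_assoc, neg_mul, Complex.I_mul_I, neg_neg, one_mul]
    rw [← Complex.ofReal_pow, show (1 / 2 : ℂ) = ((1 / 2 : ℝ) : ℂ) by push_cast; rfl,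
      ← Complex.ofReal_cpow (by positivity), ← Real.sqrt_eq_rpow, Real.sqrt_sq ht.le]
  rw [hsqrt, jacobiTheta₂, jacobiTheta₂] at hfe
  have hl : ∑' a : ℤ, ((t * Real.exp (-Real.pi * ((a - α) * t) ^ 2) : ℝ) : ℂ) * mexp (a * w) =
      t * Complex.exp (-Real.pi * t ^ 2 * α ^ 2) *
        ∑' a : ℤ, jacobiTheta₂_term a (w - Complex.I * t ^ 2 * α) (Complex.I * t ^ 2) := by
    rw [← tsum_mul_left]
    refine tsum_congr fun a => ?_
    rw [jacobiTheta₂_term, mexp]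
    push_cast
    rw [mul_assoc (t : ℂ), mul_assoc (t : ℂ), ← Complex.exp_add, ← Complex.exp_add]
    congr 2
    linear_combination (2 * Real.pi * a * t ^ 2 * α - Real.pi * a ^ 2 * t ^ 2) * Complex.I_sq
  rw [hl, hfe, ← tsum_mul_left, ← tsum_mul_left, ← (Equiv.neg ℤ).tsum_eq]
  refine tsum_congr fun b => ?_
  rw [jacobiTheta₂_term, gaussTerm, Equiv.neg_apply]
  rw [show ∀ A B C : ℂ, (t : ℂ) * A * (1 / t * B * C) = A * B * C by intros; field_simp]
  rw [← Complex.exp_add, ← Complex.exp_add]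
  congr 1
  push_cast
  field_simp
  ring_nf
  simp only [Complex.I_sq]
  ring

lemma summable_stepSign_sub_Efun_mul_mexp (s : ℤ) (α : ℝ) {t : ℝ} (ht : 0 < t) (w : ℂ) :
    Summable fun a : ℤ => ((stepSign s a - Efun ((a - α) * t) : ℝ) : ℂ) * mexp (a * w) := by
  refine (summable_stepSign_sub_Efun s α ht (c := 0) (d := 2 * Real.pi * Complex.I * w)
    (by rw [Complex.zero_re]; have := Real.pi_pos; positivity)).congr fun a => ?_
  rw [mexp]
  congr 2
  ring

lemma hasDerivAt_tsum_stepSign_sub_Efun (s : ℤ) {t : ℝ} (ht : 0 < t) (w : ℂ) (α : ℝ) :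
    HasDerivAt (fun α : ℝ => ∑' a : ℤ,
      ((stepSign s a - Efun ((a - α) * t) : ℝ) : ℂ) * mexp (a * w))
      (∑' a : ℤ, 2 * (((t * Real.exp (-Real.pi * ((a - α) * t) ^ 2) : ℝ) : ℂ) * mexp (a * w)))
      α := by
  obtain ⟨R, hR⟩ : ∃ R : ℝ, |α| < R := ⟨|α| + 1, lt_add_one _⟩
  have hu : Summable fun a : ℤ => 2 * t * Real.exp (Real.pi * R ^ 2 * t ^ 2) *
      ‖Complex.exp (((-(Real.pi * t ^ 2 / 2) : ℝ) : ℂ) * a ^ 2 +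
        2 * Real.pi * Complex.I * w * a)‖ := by
    refine (summable_cexp_quadratic ?_).norm.mul_left _
    rw [Complex.ofReal_re]
    have := Real.pi_pos
    exact neg_neg_of_pos (by positivity)
  have hα : α ∈ Metric.ball (0 : ℝ) R := by rwa [mem_ball_zero_iff, Real.norm_eq_abs]
  refine hasDerivAt_tsum_of_isPreconnected
    (g := fun (a : ℤ) (y : ℝ) => ((stepSign s a - Efun ((a - y) * t) : ℝ) : ℂ) * mexp (a * w))
    (g' := fun (a : ℤ) (y : ℝ) =>
      2 * (((t * Real.exp (-Real.pi * ((a - y) * t) ^ 2) : ℝ) : ℂ) * mexp (a * w)))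
    hu Metric.isOpen_ball
    (convex_ball (0 : ℝ) R).isPreconnected (fun a y _ => ?_) (fun a y hy => ?_) hα
    (summable_stepSign_sub_Efun_mul_mexp s α ht w) hα
  · have h1 : HasDerivAt (fun y : ℝ => ((a : ℝ) - y) * t) (-1 * t) y :=
      ((hasDerivAt_id y).const_sub (a : ℝ)).mul_const t
    have h2 := ((hasDerivAt_Efun _).comp y h1).const_sub (stepSign s a)
    refine (h2.ofReal_comp.mul_const (mexp (a * w))).congr_deriv ?_
    push_cast
    ring
  · rw [mexp, norm_mul, norm_mul, Complex.norm_real, RCLike.norm_ofNat, Real.norm_eq_abs,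
      abs_of_pos (by positivity), mul_assoc t, ← mul_assoc 2 t, mul_assoc (2 * t)]
    refine mul_le_mul_of_nonneg_left ?_ (by positivity)
    rw [Complex.norm_exp, Complex.norm_exp, ← Real.exp_add, ← Real.exp_add, Real.exp_le_exp]
    have h3 : (((-(Real.pi * t ^ 2 / 2) : ℝ) : ℂ) * (a : ℂ) ^ 2 + 2 * Real.pi * Complex.I * w * a)
        = 2 * Real.pi * Complex.I * (a * w) + ((-(Real.pi * t ^ 2 / 2) * a ^ 2 : ℝ) : ℂ) := by
      push_cast; ring
    rw [h3, Complex.add_re, Complex.ofReal_re]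
    rw [mem_ball_zero_iff, Real.norm_eq_abs] at hy
    have h4 : y ^ 2 ≤ R ^ 2 := sq_le_sq' (by linarith [neg_abs_le y]) (by linarith [le_abs_self y])
    have h5 : (a : ℝ) ^ 2 / 2 - R ^ 2 ≤ (a - y) ^ 2 := by nlinarith [sq_nonneg ((a : ℝ) - 2 * y)]
    have h6 := mul_le_mul_of_nonneg_left h5 (mul_nonneg Real.pi_pos.le (sq_nonneg t))
    nlinarith [h6]

lemma hasDerivAt_tsum_gaussTerm_div {t : ℝ} (ht : 0 < t) {w : ℂ} (hw : ∀ b : ℤ, w + b ≠ 0)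
    (α : ℝ) :
    HasDerivAt (fun α : ℝ => ∑' b : ℤ, gaussTerm t α (w + b) / (w + b))
      (∑' b : ℤ, 2 * Real.pi * Complex.I * gaussTerm t α (w + b)) α := by
  obtain ⟨R, hR⟩ : ∃ R : ℝ, |α| < R := ⟨|α| + 1, lt_add_one _⟩
  have hu : Summable fun b : ℤ => 2 * Real.pi * Real.exp (2 * Real.pi * R * |w.im|) *
      ‖gaussTerm t 0 (w + b)‖ := (summable_gaussTerm ht 0 w).norm.mul_left _
  have hα : α ∈ Metric.ball (0 : ℝ) R := by rwa [mem_ball_zero_iff, Real.norm_eq_abs]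
  refine hasDerivAt_tsum_of_isPreconnected
    (g := fun (b : ℤ) (y : ℝ) => gaussTerm t y (w + b) / (w + b))
    (g' := fun (b : ℤ) (y : ℝ) => 2 * Real.pi * Complex.I * gaussTerm t y (w + b))
    hu Metric.isOpen_ball
    (convex_ball (0 : ℝ) R).isPreconnected (fun b y _ => ?_) (fun b y hy => ?_) hα
    (summable_gaussTerm_div ht α w) hα
  · have h1 : HasDerivAt (fun y : ℝ => (y : ℂ)) 1 y := Complex.ofRealCLM.hasDerivAt
    have h2 := (((h1.const_mul (2 * Real.pi * Complex.I)).mul_const (w + b)).const_add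
      (-(Real.pi : ℂ) * ((w + b) / t) ^ 2)).cexp.div_const (w + b)
    refine h2.congr_deriv ?_
    rw [mul_one, ← mul_assoc, mul_div_cancel_right₀ _ (hw b), mul_comm]
    rfl
  · have h1 : gaussTerm t y (w + b) =
        gaussTerm t 0 (w + b) * Complex.exp (2 * Real.pi * Complex.I * y * (w + b)) := by
      rw [gaussTerm, gaussTerm, ← Complex.exp_add]
      congr 1
      push_cast
      ring
    have h2 : ‖(2 * Real.pi * Complex.I : ℂ)‖ = 2 * Real.pi := by
      simp [abs_of_pos Real.pi_pos]
    rw [h1, norm_mul _ (gaussTerm _ _ _ * _), norm_mul (gaussTerm _ _ _), h2, mul_assoc (2 * Real.pi), mul_comm (Real.exp _)]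
    refine mul_le_mul_of_nonneg_left (mul_le_mul_of_nonneg_left ?_ (norm_nonneg _))
      (by have := Real.pi_pos; positivity)
    rw [Complex.norm_exp, Real.exp_le_exp]
    have h3 : (2 * Real.pi * Complex.I * y * (w + b) : ℂ).re = 2 * Real.pi * (-(y * w.im)) := by
      rw [show (2 * Real.pi * Complex.I * y * (w + b) : ℂ) =
        ((2 * Real.pi * y : ℝ) : ℂ) * (Complex.I * (w + b)) by push_cast; ring,
        Complex.re_ofReal_mul]
      simp
      ring
    rw [h3, mul_assoc _ R]
    refine mul_le_mul_of_nonneg_left ?_ (by have := Real.pi_pos; positivity)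
    rw [mem_ball_zero_iff, Real.norm_eq_abs] at hy
    calc -(y * w.im) ≤ |y * w.im| := neg_le_abs _
      _ = |y| * |w.im| := abs_mul _ _
      _ ≤ R * |w.im| := mul_le_mul_of_nonneg_right hy.le (abs_nonneg _)

lemma mexp_add (u v : ℂ) : mexp (u + v) = mexp u * mexp v := by
  rw [mexp, mexp, mexp, ← Complex.exp_add, mul_add]

lemma mexp_intCast (k : ℤ) : mexp k = 1 := by
  rw [mexp, mul_comm, Complex.exp_int_mul_two_pi_mul_I]

lemma mexp_ne_one {w : ℂ} (hw : ∀ b : ℤ, w + b ≠ 0) : mexp w ≠ 1 := by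
  rw [mexp, Ne, Complex.exp_eq_one_iff]
  rintro ⟨k, hk⟩
  refine hw (-k) ?_
  have h : w = k := by
    refine mul_left_cancel₀ Complex.two_pi_I_ne_zero ?_
    rw [hk, mul_comm]
  rw [h]
  push_cast
  ring

/-- The regularization `x^s / (1 - x) - ½ ∑ₐ (sgn(a ≥ s) - E((a - α) t)) x^a`, `x = e^{2πi w}`. -/
noncomputable def appellCoeff (t α : ℝ) (s : ℤ) (w : ℂ) : ℂ :=
  mexp (s * w) / (1 - mexp w) -
    1 / 2 * ∑' a : ℤ, ((stepSign s a - Efun ((a - α) * t) : ℝ) : ℂ) * mexp (a * w)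

lemma appellCoeff_add_one {t : ℝ} (ht : 0 < t) (α : ℝ) (s : ℤ) {w : ℂ} (hw : mexp w ≠ 1) :
    appellCoeff t α (s + 1) w = appellCoeff t α s w := by
  have h1 : (1 - mexp w) ≠ 0 := sub_ne_zero.2 hw.symm
  have h2 : (∑' a : ℤ, ((stepSign s a - Efun ((a - α) * t) : ℝ) : ℂ) * mexp (a * w)) -
      ∑' a : ℤ, ((stepSign (s + 1) a - Efun ((a - α) * t) : ℝ) : ℂ) * mexp (a * w) =
      2 * mexp (s * w) := by
    rw [← (summable_stepSign_sub_Efun_mul_mexp s α ht w).tsum_sub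
      (summable_stepSign_sub_Efun_mul_mexp (s + 1) α ht w), tsum_eq_single s]
    · rw [stepSign, stepSign, if_pos le_rfl, if_neg (by omega)]
      push_cast
      ring
    · intro a ha
      rw [← sub_mul, ← Complex.ofReal_sub, sub_sub_sub_cancel_right]
      have : stepSign s a = stepSign (s + 1) a := by
        unfold stepSign
        congr 1
        simp only [eq_iff_iff]
        omega
      rw [this, sub_self, Complex.ofReal_zero, zero_mul]
  have h3 : mexp (((s + 1 : ℤ) : ℂ) * w) = mexp (s * w) * mexp w := by
    rw [← mexp_add]; congr 1; push_cast; ring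
  have h4 : mexp (s * w) / (1 - mexp w) - mexp (s * w) * mexp w / (1 - mexp w) =
      mexp (s * w) := by
    field_simp
  rw [appellCoeff, appellCoeff, h3]
  linear_combination 1 / 2 * h2 - h4

lemma appellCoeff_shift (t α : ℝ) (s : ℤ) (w : ℂ) :
    appellCoeff t (α + 1) (s + 1) w = mexp w * appellCoeff t α s w := by
  have hm (a : ℤ) : mexp (((a + 1 : ℤ) : ℂ) * w) = mexp w * mexp (a * w) := by
    rw [← mexp_add]; congr 1; push_cast; ring
  have hre := (Equiv.addRight (1 : ℤ)).tsum_eq fun a : ℤ =>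
    ((stepSign (s + 1) a - Efun ((a - ((α + 1 : ℝ) : ℝ)) * t) : ℝ) : ℂ) * mexp (a * w)
  rw [appellCoeff, appellCoeff, ← hre, mul_sub, mul_left_comm (mexp w),
    ← tsum_mul_left (a := mexp w), hm, mul_div_assoc]
  congr 2
  refine tsum_congr fun a => ?_
  rw [Equiv.coe_addRight, hm, mul_left_comm]
  congr 4
  · unfold stepSign
    congr 1
    simp
  · push_cast
    ring_nf

lemma gaussTerm_shift (t α : ℝ) (w : ℂ) (b : ℤ) :
    gaussTerm t (α + 1) (w + b) = mexp w * gaussTerm t α (w + b) := by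
  have h : mexp w = mexp (w + b) := by rw [mexp_add, mexp_intCast, mul_one]
  rw [h, gaussTerm, gaussTerm, mexp, ← Complex.exp_add]
  congr 1
  push_cast
  ring

lemma appellCoeff_eq_tsum_gaussTerm {t : ℝ} (ht : 0 < t) (α : ℝ) (s : ℤ) {w : ℂ}
    (hw : ∀ b : ℤ, w + b ≠ 0) :
    appellCoeff t α s w =
      -(2 * Real.pi * Complex.I)⁻¹ * ∑' b : ℤ, gaussTerm t α (w + b) / (w + b) := by
  have hx := mexp_ne_one hw
  set G : ℝ → ℂ := fun α => appellCoeff t α s w +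
    (2 * Real.pi * Complex.I)⁻¹ * ∑' b : ℤ, gaussTerm t α (w + b) / (w + b) with hG
  have hd (α : ℝ) : HasDerivAt G 0 α := by
    have h := (((hasDerivAt_tsum_stepSign_sub_Efun s ht w α).const_mul (1 / 2 : ℂ)).const_sub
      (mexp (s * w) / (1 - mexp w))).add
      ((hasDerivAt_tsum_gaussTerm_div ht hw α).const_mul (2 * Real.pi * Complex.I)⁻¹)
    refine h.congr_deriv ?_
    rw [tsum_mul_left, tsum_mul_left, tsum_gaussian_mul_mexp ht,
      inv_mul_cancel_left₀ Complex.two_pi_I_ne_zero]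
    ring
  have hconst : G (α + 1) = G α :=
    is_const_of_deriv_eq_zero (fun x => (hd x).differentiableAt) (fun x => (hd x).deriv) _ _
  have hshift : G (α + 1) = mexp w * G α := by
    simp only [hG]
    rw [← appellCoeff_add_one ht (α + 1) s hx, appellCoeff_shift, mul_add, mul_left_comm (mexp w)]
    simp only [gaussTerm_shift, mul_div_assoc, tsum_mul_left]
  have h0 : (1 - mexp w) * G α = 0 := by linear_combination hshift - hconst
  have h1 : G α = 0 := (mul_eq_zero.1 h0).resolve_left (sub_ne_zero.2 hx.symm)
  rw [neg_mul]
  exact eq_neg_of_add_eq_zero_left h1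

/-! ### Unfolding the modifier -/

lemma tsum_eq_sum_residues {f : ℤ → ℂ} (hf : Summable f) (s : ℤ) (N : ℕ) [NeZero N] :
    ∑' a : ℤ, f a = ∑ i ∈ Finset.range N, ∑' k : ℤ, f (s + i + N * k) := by
  let e : Fin N × ℤ ≃ ℤ :=
    (Equiv.prodComm _ _).trans ((Int.divModEquiv N).symm.trans (Equiv.addLeft s))
  have he (p : Fin N × ℤ) : e p = s + (p.1 : ℕ) + N * p.2 := by
    simp only [e, Equiv.trans_apply, Equiv.prodComm_apply, Int.divModEquiv, Equiv.coe_fn_symm_mk,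
      Equiv.coe_addLeft, Prod.swap]
    ring
  refine (e.tsum_eq f).symm.trans ((e.summable_iff.2 hf).tsum_prod.trans ?_)
  rw [tsum_fintype, Finset.sum_range fun i => ∑' k : ℤ, f (s + i + N * k)]
  simp only [Function.comp_apply, he]

/-- The `(n, a)` term in the expansion of the modifier `Φ_add` as a double series. -/
noncomputable def addTerm (M : ℕ) (s : ℤ) (τ z₁ z₂ : ℂ) (n a : ℤ) : ℂ :=
  mexp (M * n * (z₁ + z₂) + τ * (M * n ^ 2)) *
    (((stepSign s a - Efun ((a - M * (z₁ - z₂).im / τ.im) * √(τ.im / M)) : ℝ) : ℂ) *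
      mexp (a * (z₁ + n * τ)))

lemma real_sign_eq_stepSign {M i : ℕ} (hi : i < 2 * M) (s k : ℤ) :
    Real.sign ((s + i : ℝ) + 2 * M * k - 1 / 2 - (s + i) + 2 * M) =
      stepSign s (s + i + 2 * M * k) := by
  have h1 : (s + i : ℝ) + 2 * M * k - 1 / 2 - (s + i) + 2 * M =
      ((2 * M * (k + 1) : ℤ) : ℝ) - 1 / 2 := by push_cast; ring
  rw [h1, stepSign]
  rcases le_or_gt 0 k with hk | hk
  · have h2 : (1 : ℤ) ≤ 2 * M * (k + 1) := by nlinarith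
    have h3 : (1 : ℝ) ≤ ((2 * M * (k + 1) : ℤ) : ℝ) := by exact_mod_cast h2
    rw [if_pos (by nlinarith), Real.sign_of_pos (by linarith)]
  · have h2 : (2 * M * (k + 1) : ℤ) ≤ 0 := by nlinarith
    have h3 : ((2 * M * (k + 1) : ℤ) : ℝ) ≤ 0 := by exact_mod_cast h2
    rw [if_neg (by nlinarith), Real.sign_of_neg (by linarith)]

lemma RS_eq_tsum {M i : ℕ} (hi : i < 2 * M) (s : ℤ) (τ z₁ z₂ : ℂ) :
    RS 1 ((s : ℝ) + i) M τ ((z₁ - z₂) / 2) = ∑' k : ℤ,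
      (fun a : ℤ => ((stepSign s a -
        Efun ((a - M * (z₁ - z₂).im / τ.im) * √(τ.im / M)) : ℝ) : ℂ) *
        Complex.exp (-(Real.pi * Complex.I * τ / (2 * M)) * a ^ 2 +
          Real.pi * Complex.I * (z₁ - z₂) * a)) (s + i + 2 * M * k) := by
  refine tsum_congr fun k => ?_
  have h2 : ((z₁ - z₂) / 2).im = (z₁ - z₂).im / 2 := by
    rw [Complex.div_ofNat_im]
  rw [one_zpow, one_mul, real_sign_eq_stepSign hi, psiMN, h2]
  refine congrArg₂ (· * ·) ?_ (congrArg Complex.exp ?_)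
  · congr 3
    push_cast
    ring
  · push_cast
    ring

lemma summable_RS_terms {M : ℕ} (hM : 0 < M) (s : ℤ) {τ : ℂ} (hτ : 0 < τ.im) (z₁ z₂ : ℂ) :
    Summable fun a : ℤ => ((stepSign s a -
        Efun ((a - M * (z₁ - z₂).im / τ.im) * √(τ.im / M)) : ℝ) : ℂ) *
        Complex.exp (-(Real.pi * Complex.I * τ / (2 * M)) * a ^ 2 +
          Real.pi * Complex.I * (z₁ - z₂) * a) := by
  have hM' : (0 : ℝ) < M := by exact_mod_cast hM
  refine summable_stepSign_sub_Efun s _ (Real.sqrt_pos.2 (div_pos hτ hM')) ?_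
  have h1 : -(Real.pi * Complex.I * τ / (2 * M)) =
      ((Real.pi / (2 * M) : ℝ) : ℂ) * (-Complex.I * τ) := by push_cast; ring
  rw [Real.sq_sqrt (div_pos hτ hM').le, h1, Complex.re_ofReal_mul]
  have h2 : (-Complex.I * τ).re = τ.im := by simp
  rw [h2]
  have h3 : 0 < Real.pi * (τ.im / M) := mul_pos Real.pi_pos (div_pos hτ hM')
  have h4 : Real.pi / (2 * M) * τ.im = Real.pi * (τ.im / M) / 2 := by field_simp
  linarith

lemma summable_ThetaS_terms {M : ℕ} (hM : 0 < M) (j : ℝ) {τ : ℂ} (hτ : 0 < τ.im) (z : ℂ) :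
    Summable fun p : ℤ => mexp (M * z * (p + ((j / (2 * M) : ℝ) : ℂ)) +
      τ * M * (p + ((j / (2 * M) : ℝ) : ℂ)) ^ 2) := by
  have hM' : (0 : ℝ) < M := by exact_mod_cast hM
  set r : ℂ := ((j / (2 * M) : ℝ) : ℂ)
  have hc : (2 * Real.pi * Complex.I * (τ * M)).re < 0 := by
    have h1 : 2 * Real.pi * Complex.I * (τ * M) =
        ((2 * Real.pi * M : ℝ) : ℂ) * (Complex.I * τ) := by push_cast; ring
    rw [h1, Complex.re_ofReal_mul]
    have h2 : (Complex.I * τ).re = -τ.im := by simp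
    rw [h2, mul_neg]
    have := Real.pi_pos
    exact neg_neg_of_pos (by positivity)
  refine ((summable_cexp_quadratic
    (d := 2 * Real.pi * Complex.I * (M * z + 2 * τ * M * r)) hc).mul_left
    (Complex.exp (2 * Real.pi * Complex.I * (M * z * r + τ * M * r ^ 2)))).congr fun p => ?_
  rw [mexp, ← Complex.exp_add]
  congr 1
  ring

lemma RS_mul_ThetaS {M i : ℕ} (hM : 0 < M) (hi : i < 2 * M) (s : ℤ) {τ : ℂ} (hτ : 0 < τ.im)
    (z₁ z₂ : ℂ) :
    (Summable fun p : ℤ × ℤ => addTerm M s τ z₁ z₂ p.1 (s + i + 2 * M * p.2)) ∧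
    RS 1 ((s : ℝ) + i) M τ ((z₁ - z₂) / 2) * ThetaS 1 ((s : ℝ) + i) M τ (z₁ + z₂) =
      ∑' n : ℤ, ∑' k : ℤ, addTerm M s τ z₁ z₂ n (s + i + 2 * M * k) := by
  have hM' : (M : ℂ) ≠ 0 := by exact_mod_cast hM.ne'
  have hinj : Function.Injective fun k : ℤ => s + i + 2 * M * k := fun k l h => by
    have h1 : (2 * M : ℤ) ≠ 0 := by positivity
    exact mul_left_cancel₀ h1 (add_left_cancel h)
  have hR := ((summable_RS_terms hM s hτ z₁ z₂).comp_injective hinj).norm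
  have hT := (summable_ThetaS_terms hM ((s : ℝ) + i) hτ (z₁ + z₂)).norm
  let e : ℤ × ℤ ≃ ℤ × ℤ :=
    { toFun := fun p => (p.2, p.1 + p.2)
      invFun := fun p => (p.2 - p.1, p.1)
      left_inv := fun p => by simp
      right_inv := fun p => by simp }
  have hs := e.summable_iff.2 (summable_mul_of_summable_norm hR hT)
  have hterm (p : ℤ × ℤ) : addTerm M s τ z₁ z₂ p.1 (s + i + 2 * M * p.2) =
      (((fun a : ℤ => ((stepSign s a -
        Efun ((a - M * (z₁ - z₂).im / τ.im) * √(τ.im / M)) : ℝ) : ℂ) *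
        Complex.exp (-(Real.pi * Complex.I * τ / (2 * M)) * a ^ 2 +
          Real.pi * Complex.I * (z₁ - z₂) * a)) ∘ fun k : ℤ => s + i + 2 * M * k) (e p).1) *
      mexp (M * (z₁ + z₂) * ((e p).2 + ((((s : ℝ) + i) / (2 * M) : ℝ) : ℂ)) +
        τ * M * ((e p).2 + ((((s : ℝ) + i) / (2 * M) : ℝ) : ℂ)) ^ 2) := by
    simp only [e, Equiv.coe_fn_mk, Function.comp_apply, addTerm, mexp]
    rw [mul_left_comm, mul_assoc (Complex.ofReal _), ← Complex.exp_add, ← Complex.exp_add]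
    congr 2
    push_cast
    field_simp
    ring
  have hs' : Summable fun p : ℤ × ℤ => addTerm M s τ z₁ z₂ p.1 (s + i + 2 * M * p.2) :=
    hs.congr fun p => (hterm p).symm
  refine ⟨hs', ?_⟩
  have hth : ThetaS 1 ((s : ℝ) + i) M τ (z₁ + z₂) = ∑' p : ℤ,
      mexp (M * (z₁ + z₂) * (p + ((((s : ℝ) + i) / (2 * M) : ℝ) : ℂ)) +
      τ * M * (p + ((((s : ℝ) + i) / (2 * M) : ℝ) : ℂ)) ^ 2) := by
    simp [ThetaS]
  rw [← hs'.tsum_prod, RS_eq_tsum hi, hth]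
  refine (tsum_mul_tsum_of_summable_norm hR hT).trans ?_
  rw [← e.tsum_eq]
  exact tsum_congr fun p => (hterm p).symm

lemma summable_addTerm {M : ℕ} (hM : 0 < M) (s : ℤ) {τ : ℂ} (hτ : 0 < τ.im) (z₁ z₂ : ℂ)
    (n : ℤ) : Summable fun a : ℤ => addTerm M s τ z₁ z₂ n a := by
  have hM' : (0 : ℝ) < M := by exact_mod_cast hM
  exact (summable_stepSign_sub_Efun_mul_mexp s _ (Real.sqrt_pos.2 (div_pos hτ hM')) _).mul_left _

lemma PhiAddS_eq_tsum {M : ℕ} (hM : 0 < M) (s : ℤ) {τ : ℂ} (hτ : 0 < τ.im) (z₁ z₂ : ℂ) :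
    (Summable fun n : ℤ => ∑' a : ℤ, addTerm M s τ z₁ z₂ n a) ∧
    PhiAddS 1 M s τ z₁ z₂ = ∑' n : ℤ, ∑' a : ℤ, addTerm M s τ z₁ z₂ n a := by
  have : NeZero (2 * M) := ⟨by omega⟩
  have hfib (n : ℤ) : ∑' a : ℤ, addTerm M s τ z₁ z₂ n a =
      ∑ i ∈ Finset.range (2 * M), ∑' k : ℤ, addTerm M s τ z₁ z₂ n (s + i + 2 * M * k) := by
    rw [tsum_eq_sum_residues (summable_addTerm hM s hτ z₁ z₂ n) s (2 * M)]
    push_cast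
    rfl
  have hsum (i : ℕ) (hi : i ∈ Finset.range (2 * M)) :
      Summable fun n : ℤ => ∑' k : ℤ, addTerm M s τ z₁ z₂ n (s + i + 2 * M * k) :=
    (RS_mul_ThetaS hM (Finset.mem_range.1 hi) s hτ z₁ z₂).1.prod
  have hceil : ⌈2 * (M : ℝ)⌉₊ = 2 * M := by
    rw [← Nat.cast_ofNat, ← Nat.cast_mul, Nat.ceil_natCast]
  simp only [hfib]
  refine ⟨summable_sum hsum, ?_⟩
  rw [Summable.tsum_finsetSum hsum, PhiAddS, hceil]
  exact Finset.sum_congr rfl fun i hi => (RS_mul_ThetaS hM (Finset.mem_range.1 hi) s hτ z₁ z₂).2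

/-! ### The expansion of `Φ̃` as a lattice sum -/

/-- The contribution of a lattice point `l ∈ ℤτ + ℤ` to `-2πi Φ̃`. -/
noncomputable def latticeTerm (M : ℕ) (τ z₁ z₂ l : ℂ) : ℂ :=
  Complex.exp (Real.pi * M / τ.im * (-(z₁ + l) * conj (z₁ + l) + conj z₂ * (z₁ + l) -
    z₂ * conj l - z₁ * z₂)) / (z₁ + l)

lemma mexp_mul_gaussTerm {M : ℕ} (hM : 0 < M) {τ : ℂ} (hτ : 0 < τ.im) (z₁ z₂ : ℂ) (n b : ℤ) :
    mexp (M * n * (z₁ + z₂) + τ * (M * n ^ 2)) *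
      (gaussTerm (√(τ.im / M)) (M * (z₁ - z₂).im / τ.im) (z₁ + n * τ + b) / (z₁ + n * τ + b)) =
    latticeTerm M τ z₁ z₂ (n * τ + b) := by
  have hM' : (0 : ℝ) < M := by exact_mod_cast hM
  have hMc : (M : ℂ) ≠ 0 := by exact_mod_cast hM.ne'
  have hy : (τ.im : ℂ) ≠ 0 := by exact_mod_cast hτ.ne'
  have hsq : ((√(τ.im / M) : ℝ) : ℂ) ^ 2 = τ.im / M := by
    rw [← Complex.ofReal_pow, Real.sq_sqrt (div_pos hτ hM').le]
    push_cast
    rfl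
  have hconj (z : ℂ) : conj z = z - 2 * Complex.I * z.im := by
    apply Complex.ext
    · simp
    · simp; ring
  rw [latticeTerm, mul_div_assoc', ← add_assoc, mexp, gaussTerm, ← Complex.exp_add]
  congr 1
  rw [Complex.exp_eq_exp_iff_exists_int]
  refine ⟨-(M * n * b), ?_⟩
  rw [div_pow, hsq, Complex.sub_im]
  simp only [map_add, map_mul, hconj z₁, hconj z₂, hconj τ,
    map_intCast]
  push_cast
  generalize (τ.im : ℂ) = y at *
  field_simp
  ring_nf

lemma summable_latticeTerm {M : ℕ} (hM : 0 < M) {τ : ℂ} (hτ : 0 < τ.im) (z₁ z₂ : ℂ) :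
    Summable fun p : ℤ × ℤ => latticeTerm M τ z₁ z₂ (p.1 * τ + p.2) := by
  let c : ℝ := Real.pi * M / τ.im
  have hc : 0 < c := by
    have hM' : (0 : ℝ) < M := by exact_mod_cast hM
    exact div_pos (mul_pos Real.pi_pos hM') hτ
  let e : (Fin 2 → ℤ) ≃ ℤ × ℤ := finTwoArrowEquiv ℤ
  rw [← e.summable_iff]
  have hr := EisensteinSeries.r_pos ⟨τ, hτ⟩
  set r := EisensteinSeries.r ⟨τ, hτ⟩
  have hlow (x : Fin 2 → ℤ) : r * ‖x‖ - ‖z₁‖ ≤ ‖z₁ + (x 0 * τ + x 1)‖ := by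
    have h1 : r * ‖x‖ ≤ ‖(x 0 * τ + x 1 : ℂ)‖ := by
      rcases eq_or_ne x 0 with rfl | hx
      · simp
      · exact EisensteinSeries.r_mul_max_le ⟨τ, hτ⟩ hx
    have h2 := norm_sub_le (z₁ + (x 0 * τ + x 1)) z₁
    rw [add_sub_cancel_left] at h2
    linarith
  have hnorm (x : Fin 2 → ℤ) : ‖latticeTerm M τ z₁ z₂ (x 0 * τ + x 1)‖ =
      Real.exp (c * (conj z₂ * z₁ - z₁ * z₂).re) *
        (Real.exp (-c * ‖z₁ + (x 0 * τ + x 1)‖ ^ 2) / ‖z₁ + (x 0 * τ + x 1)‖) := by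
    rw [latticeTerm, norm_div, Complex.norm_exp, ← mul_div_assoc, ← Real.exp_add]
    congr 2
    generalize (x 0 * τ + x 1 : ℂ) = l
    have hre : (-(z₁ + l) * conj (z₁ + l) + conj z₂ * (z₁ + l) - z₂ * conj l - z₁ * z₂).re =
        (conj z₂ * z₁ - z₁ * z₂).re - ‖z₁ + l‖ ^ 2 := by
      rw [neg_mul, Complex.mul_conj, Complex.normSq_eq_norm_sq]
      simp only [Complex.add_re, Complex.sub_re, Complex.neg_re, Complex.mul_re, Complex.conj_re,
        Complex.conj_im, Complex.add_im, Complex.ofReal_re]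
      ring
    rw [show (Real.pi * M / τ.im : ℂ) = ((c : ℝ) : ℂ) by simp only [c]; push_cast; rfl,
      Complex.re_ofReal_mul, hre]
    ring
  have htend : Tendsto (fun x : Fin 2 → ℤ => ‖x‖) cofinite atTop :=
    tendsto_norm_comp_cofinite_atTop_of_isClosedEmbedding Topology.IsClosedEmbedding.id
  have hX : Tendsto (fun x : Fin 2 → ℤ => ‖z₁ + (x 0 * τ + x 1)‖) cofinite atTop :=
    tendsto_atTop_mono hlow
      (tendsto_atTop_add_const_right _ _ (htend.const_mul_atTop hr))
  refine EisensteinSeries.summable_of_isBigO_rpow_norm (a := 3) (by norm_num) ?_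
  have hexp : (fun X : ℝ => Real.exp (-c * X ^ 2) / X) =O[atTop] fun X : ℝ => (X ^ 3)⁻¹ := by
    have h1 : (fun X : ℝ => Real.exp (-c * X)) =o[atTop] fun X : ℝ => X ^ (-1 : ℝ) :=
      isLittleO_exp_neg_mul_rpow_atTop hc (-1)
    have h2 := (h1.comp_tendsto (tendsto_pow_atTop (α := ℝ) two_ne_zero)).isBigO.mul
      (isBigO_refl (fun X : ℝ => X⁻¹) atTop)
    refine h2.congr (fun X => by simp [div_eq_mul_inv]) fun X => ?_
    simp only [Function.comp_apply, Real.rpow_neg_one]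
    rw [← mul_inv, ← pow_succ]
  have h1 : (fun x : Fin 2 → ℤ => latticeTerm M τ z₁ z₂ (x 0 * τ + x 1)) =O[cofinite]
      fun x => (‖z₁ + (x 0 * τ + x 1)‖ ^ 3)⁻¹ := by
    rw [← isBigO_norm_left]
    simp only [hnorm]
    exact (hexp.comp_tendsto hX).const_mul_left _
  refine h1.trans (IsBigO.of_bound ((2 / r) ^ 3) ?_)
  filter_upwards [htend.eventually_ge_atTop (2 * ‖z₁‖ / r), htend.eventually_gt_atTop 0]
    with x hx hx0
  have h3 : r / 2 * ‖x‖ ≤ ‖z₁ + (x 0 * τ + x 1)‖ := by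
    have h4 := hlow x
    rw [div_le_iff₀ hr] at hx
    linarith
  have h5 : (‖x‖ : ℝ) ^ (3 : ℝ) = ‖x‖ ^ 3 := by exact_mod_cast Real.rpow_natCast ‖x‖ 3
  rw [norm_inv, norm_inv, h5, norm_pow, norm_pow, norm_norm, norm_norm, ← inv_pow, ← inv_pow,
    ← mul_pow]
  refine pow_le_pow_left₀ (by positivity) ?_ 3
  calc ‖z₁ + (x 0 * τ + x 1)‖⁻¹ ≤ (r / 2 * ‖x‖)⁻¹ := inv_anti₀ (by positivity) h3
    _ = 2 / r * ‖x‖⁻¹ := by rw [mul_inv, inv_div]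

lemma PhiTilde_eq_tsum_latticeTerm {M : ℕ} (hM : 0 < M) (s : ℤ) {τ z₁ z₂ : ℂ} (hτ : 0 < τ.im)
    (hz : ∀ a b : ℤ, z₁ ≠ a + b * τ) :
    PhiTilde 1 M s τ z₁ z₂ = -(2 * Real.pi * Complex.I)⁻¹ *
      ∑' p : ℤ × ℤ, latticeTerm M τ z₁ z₂ (p.1 * τ + p.2) := by
  have hM' : (0 : ℝ) < M := by exact_mod_cast hM
  have ht : 0 < √(τ.im / M) := Real.sqrt_pos.2 (div_pos hτ hM')
  have hw (n b : ℤ) : z₁ + n * τ + b ≠ 0 := fun h => by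
    refine hz (-b) (-n) ?_
    push_cast
    linear_combination h
  have hL := summable_latticeTerm hM hτ z₁ z₂
  have hfib (n : ℤ) : -(2 * Real.pi * Complex.I)⁻¹ *
      ∑' b : ℤ, latticeTerm M τ z₁ z₂ (n * τ + b) =
      mexp (M * n * (z₁ + z₂) + τ * (M * n ^ 2)) *
        appellCoeff (√(τ.im / M)) (M * (z₁ - z₂).im / τ.im) s (z₁ + n * τ) := by
    rw [appellCoeff_eq_tsum_gaussTerm ht _ s (hw n), mul_left_comm (mexp _),
      ← tsum_mul_left (a := mexp _)]
    simp only [mexp_mul_gaussTerm hM hτ]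
  obtain ⟨hadd, hPhiAdd⟩ := PhiAddS_eq_tsum hM s hτ z₁ z₂
  have hPhi : PhiS 1 M s τ z₁ z₂ = ∑' n : ℤ,
      (-(2 * Real.pi * Complex.I)⁻¹ * (∑' b : ℤ, latticeTerm M τ z₁ z₂ (n * τ + b)) +
        1 / 2 * ∑' a : ℤ, addTerm M s τ z₁ z₂ n a) := by
    refine tsum_congr fun n => ?_
    have h1 : mexp ((M : ℂ) * n * (z₁ + z₂) + s * z₁ + τ * (M * n ^ 2 + s * n)) =
        mexp (M * n * (z₁ + z₂) + τ * (M * n ^ 2)) * mexp (s * (z₁ + n * τ)) := by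
      rw [← mexp_add]
      congr 1
      ring
    have h2 : ∑' a : ℤ, addTerm M s τ z₁ z₂ n a = mexp (M * n * (z₁ + z₂) + τ * (M * n ^ 2)) *
        ∑' a : ℤ, ((stepSign s a - Efun ((a - M * (z₁ - z₂).im / τ.im) * √(τ.im / M)) : ℝ) : ℂ) *
          mexp (a * (z₁ + n * τ)) := tsum_mul_left
    rw [hfib, h2, appellCoeff, one_zpow, one_mul]
    push_cast
    rw [h1]
    ring
  rw [PhiTilde, hPhi, hPhiAdd, (hL.prod.mul_left _).tsum_add (hadd.mul_left _), tsum_mul_left,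
    tsum_mul_left, hL.tsum_prod, add_sub_cancel_right]

/-! ### Modularity -/

lemma latticeTerm_modular (M : ℕ) {τ : ℂ} (hτ : 0 < τ.im) (z₁ z₂ l : ℂ) {a b c d : ℤ}
    (h : a * d - b * c = 1) (hj : (c : ℂ) * τ + d ≠ 0) :
    ((c : ℂ) * τ + d)⁻¹ *
      Complex.exp (-(2 * (Real.pi : ℂ) * Complex.I) * M * c * z₁ * z₂ / (c * τ + d)) *
      latticeTerm M ((a * τ + b) / (c * τ + d)) (z₁ / (c * τ + d)) (z₂ / (c * τ + d))
        (l / (c * τ + d)) = latticeTerm M τ z₁ z₂ l := by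
  have hy : (τ.im : ℂ) ≠ 0 := by exact_mod_cast hτ.ne'
  have hjc : (c : ℂ) * conj τ + d ≠ 0 := fun h0 => hj <| by
    have := congrArg conj h0
    simpa using this
  have hdet : (a : ℂ) * d - b * c = 1 := by exact_mod_cast h
  have hconj : conj τ = τ - 2 * Complex.I * τ.im := by
    apply Complex.ext
    · simp
    · simp; ring
  have him : ((((a * τ + b) / (c * τ + d) : ℂ).im : ℝ) : ℂ) =
      τ.im / ((c * τ + d) * (c * conj τ + d)) := by
    have h1 (z : ℂ) : (z.im : ℂ) = (z - conj z) / (2 * Complex.I) := by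
      rw [Complex.sub_conj]
      push_cast
      field_simp
    rw [h1, h1 τ, map_div₀, map_add, map_add, map_mul, map_mul]
    simp only [map_intCast]
    rw [div_sub_div _ _ hj hjc, div_right_comm]
    congr 2
    linear_combination (τ - conj τ) * hdet
  have hcj : conj (c * τ + d : ℂ) = c * conj τ + d := by simp
  rw [latticeTerm, latticeTerm, ← add_div, div_div_eq_mul_div, him]
  have hexp : Complex.exp (-(2 * (Real.pi : ℂ) * Complex.I) * M * c * z₁ * z₂ / (c * τ + d)) *
      Complex.exp (Real.pi * M / (τ.im / ((c * τ + d) * (c * conj τ + d))) *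
        (-((z₁ + l) / (c * τ + d)) * conj ((z₁ + l) / (c * τ + d)) +
          conj (z₂ / (c * τ + d)) * ((z₁ + l) / (c * τ + d)) -
          z₂ / (c * τ + d) * conj (l / (c * τ + d)) -
          z₁ / (c * τ + d) * (z₂ / (c * τ + d)))) =
      Complex.exp (Real.pi * M / τ.im * (-(z₁ + l) * conj (z₁ + l) + conj z₂ * (z₁ + l) -
        z₂ * conj l - z₁ * z₂)) := by
    rw [← Complex.exp_add]
    congr 1
    have hjj : (c : ℂ) * conj τ + d = c * τ + d - 2 * Complex.I * c * τ.im := by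
      rw [hconj]
      ring
    simp only [map_div₀, hcj]
    generalize conj (z₁ + l) = w'
    generalize conj l = l'
    generalize conj z₂ = z'
    generalize (c : ℂ) * conj τ + d = jc at *
    generalize (c : ℂ) * τ + d = j at *
    generalize (τ.im : ℂ) = y at *
    field_simp
    rw [hjj]
    ring
  rw [← hexp]
  field_simp

/-- The action of a matrix of determinant one on pairs of integers, as row vectors. -/
def rowEquiv {a b c d : ℤ} (h : a * d - b * c = 1) : ℤ × ℤ ≃ ℤ × ℤ where
  toFun p := (p.1 * a + p.2 * c, p.1 * b + p.2 * d)
  invFun p := (p.1 * d - p.2 * c, p.2 * a - p.1 * b)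
  left_inv p := by
    ext
    · linear_combination p.1 * h
    · linear_combination p.2 * h
  right_inv p := by
    ext
    · linear_combination p.1 * h
    · linear_combination p.2 * h

lemma tsum_latticeTerm_modular (M : ℕ) {τ : ℂ} (hτ : 0 < τ.im) (z₁ z₂ : ℂ) {a b c d : ℤ}
    (h : a * d - b * c = 1) (hj : (c : ℂ) * τ + d ≠ 0) :
    ((c : ℂ) * τ + d)⁻¹ *
      Complex.exp (-(2 * (Real.pi : ℂ) * Complex.I) * M * c * z₁ * z₂ / (c * τ + d)) *
      ∑' p : ℤ × ℤ, latticeTerm M ((a * τ + b) / (c * τ + d)) (z₁ / (c * τ + d))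
        (z₂ / (c * τ + d)) (p.1 * ((a * τ + b) / (c * τ + d)) + p.2) =
    ∑' p : ℤ × ℤ, latticeTerm M τ z₁ z₂ (p.1 * τ + p.2) := by
  rw [← tsum_mul_left, ← (rowEquiv h).tsum_eq fun p => latticeTerm M τ z₁ z₂ (p.1 * τ + p.2)]
  refine tsum_congr fun p => ?_
  rw [← latticeTerm_modular M hτ z₁ z₂ _ h hj]
  congr 2
  simp only [rowEquiv, Equiv.coe_fn_mk]
  push_cast
  rw [mul_div_assoc', div_add' _ _ _ hj]
  ring

lemma denom_ne_zero_of_det {τ : ℂ} (hτ : 0 < τ.im) {a b c d : ℤ} (h : a * d - b * c = 1) :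
    (c : ℂ) * τ + d ≠ 0 := fun h0 => by
  have h1 : (c : ℝ) * τ.im = 0 := by simpa using congrArg Complex.im h0
  have hc : c = 0 := by
    rcases mul_eq_zero.1 h1 with h2 | h2
    · exact_mod_cast h2
    · exact absurd h2 hτ.ne'
  subst hc
  have hd : d = 0 := by simpa using h0
  simp [hd] at h

lemma im_moebius_pos {τ : ℂ} (hτ : 0 < τ.im) {a b c d : ℤ} (h : a * d - b * c = 1) :
    0 < (((a : ℂ) * τ + b) / (c * τ + d)).im := by
  have hN : 0 < Complex.normSq (c * τ + d) := Complex.normSq_pos.2 (denom_ne_zero_of_det hτ h)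
  have hdet : (a : ℝ) * d - b * c = 1 := by exact_mod_cast h
  have h1 : (((a : ℂ) * τ + b) / (c * τ + d)).im = τ.im / Complex.normSq (c * τ + d) := by
    rw [Complex.div_im, ← sub_div]
    congr 1
    simp
    linear_combination τ.im * hdet
  rw [h1]
  exact div_pos hτ hN

lemma div_denom_not_mem_lattice {τ z : ℂ} (hz : ∀ x y : ℤ, z ≠ x + y * τ) {a b c d : ℤ}
    (hj : (c : ℂ) * τ + d ≠ 0) (x y : ℤ) :
    z / (c * τ + d) ≠ x + y * ((a * τ + b) / (c * τ + d)) := fun h0 => by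
  refine hz (x * d + y * b) (x * c + y * a) ?_
  rw [mul_div_assoc', add_div' _ _ _ hj, div_left_inj' hj] at h0
  push_cast
  linear_combination h0

/-- for `m ∈ ℤ_{>0}` the functions `Φ̃^{[m;s]}` are independent of `s ∈ ℤ`
(so one writes `Φ̃^{[m]}`), and they are fixed by the weight-1, degree-m action of
`SL₂(ℤ)` (a matrix `(a b; c d)` with `ad - bc = 1`). -/
theorem stmt3 (m : ℤ) (hm : 0 < m) :
    (∀ s s₁ : ℤ, ∀ τ z₁ z₂ : ℂ, 0 < τ.im → (∀ a b : ℤ, z₁ ≠ (a : ℂ) + (b : ℂ) * τ) →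
      PhiTilde 1 (m : ℝ) (s : ℝ) τ z₁ z₂ = PhiTilde 1 (m : ℝ) (s₁ : ℝ) τ z₁ z₂) ∧
    (∀ a b c d : ℤ, a * d - b * c = 1 → ∀ s : ℤ, ∀ τ z₁ z₂ : ℂ, 0 < τ.im →
      (∀ x y : ℤ, z₁ ≠ (x : ℂ) + (y : ℂ) * τ) →
      ((c : ℂ) * τ + (d : ℂ))⁻¹ *
        Complex.exp (-(2 * (Real.pi : ℂ) * Complex.I) * (m : ℂ) * (c : ℂ) * z₁ * z₂ /
          ((c : ℂ) * τ + (d : ℂ))) *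
        PhiTilde 1 (m : ℝ) (s : ℝ) (((a : ℂ) * τ + (b : ℂ)) / ((c : ℂ) * τ + (d : ℂ)))
          (z₁ / ((c : ℂ) * τ + (d : ℂ))) (z₂ / ((c : ℂ) * τ + (d : ℂ)))
      = PhiTilde 1 (m : ℝ) (s : ℝ) τ z₁ z₂) := by
  obtain ⟨M, rfl⟩ := Int.eq_ofNat_of_zero_le hm.le
  have hM : 0 < M := by exact_mod_cast hm
  simp only [Int.cast_natCast]
  refine ⟨fun s s₁ τ z₁ z₂ hτ hz => ?_, fun a b c d h s τ z₁ z₂ hτ hz => ?_⟩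
  · rw [PhiTilde_eq_tsum_latticeTerm hM s hτ hz, PhiTilde_eq_tsum_latticeTerm hM s₁ hτ hz]
  · have hj := denom_ne_zero_of_det hτ h
    rw [PhiTilde_eq_tsum_latticeTerm hM s hτ hz,
      PhiTilde_eq_tsum_latticeTerm hM s (im_moebius_pos hτ h) (div_denom_not_mem_lattice hz hj),
      mul_left_comm, tsum_latticeTerm_modular M hτ z₁ z₂ h hj]
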